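/- The set BMO_ℝ^*(ℝ) of all real-valued BMO functions u on ℝ such that e^u is an A_∞-weight is open in the BMO seminorm: for every real-valued BMO function u with e^u an A_∞-weight there exists ε > 0 such that every real-valued BMO function v with ‖v − u‖_* < ε also has e^v an A_∞-weight. -/

import Mathlib

open MeasureTheory Set Filter Topology
open scoped ENNReal NNReal

noncomputable section

/-- The average of `u` over the interval from `a` to `b`. -/
noncomputable def intervalAvg {E : Type*} [NormedAddCommGroup E] [NormedSpace ℝ E]
    (u : ℝ → E) (a b : ℝ) : E :=
  (b - a)⁻¹ • ∫ x in a..b, u x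

/-- The BMO seminorm `‖u‖_* = sup_I (1/|I|) ∫_I ‖u - u_I‖`, valued in `ℝ≥0∞`. -/
noncomputable def bmoSeminorm {E : Type*} [NormedAddCommGroup E] [NormedSpace ℝ E]
    (u : ℝ → E) : ℝ≥0∞ :=
  ⨆ (a : ℝ) (b : ℝ) (_ : a < b),
    ENNReal.ofReal ((b - a)⁻¹ * ∫ x in a..b, ‖u x - intervalAvg u a b‖)

/-- `u` is a BMO function: locally integrable with finite BMO seminorm. -/
def IsBMO {E : Type*} [NormedAddCommGroup E] [NormedSpace ℝ E] (u : ℝ → E) : Prop :=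
  LocallyIntegrable u volume ∧ bmoSeminorm u < ⊤

/-- `ω` is an `A_p`-weight of Muckenhoupt on `ℝ` (`p > 1`). -/
def IsApWeight (ω : ℝ → ℝ) (p : ℝ) : Prop :=
  (∀ x, 0 ≤ ω x) ∧ LocallyIntegrable ω volume ∧
    LocallyIntegrable (fun x => (1 / ω x) ^ (1 / (p - 1))) volume ∧
    ∃ C : ℝ, 1 ≤ C ∧ ∀ a b : ℝ, a < b →
      ((b - a)⁻¹ * ∫ x in a..b, ω x) *
        ((b - a)⁻¹ * ∫ x in a..b, (1 / ω x) ^ (1 / (p - 1))) ^ (p - 1) ≤ C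

/-- `ω` is an `A_∞`-weight: an `A_p`-weight for some `p > 1`. -/
def IsAInftyWeight (ω : ℝ → ℝ) : Prop :=
  ∃ p : ℝ, 1 < p ∧ IsApWeight ω p

/-- `ω` is an `A_1`-weight of Muckenhoupt on `ℝ`. -/
def IsA1Weight (ω : ℝ → ℝ) : Prop :=
  (∀ x, 0 ≤ ω x) ∧ LocallyIntegrable ω volume ∧
    ∃ C : ℝ, 1 ≤ C ∧ ∀ a b : ℝ, a < b →
      (b - a)⁻¹ * ∫ x in a..b, ω x ≤ C * essInf ω (volume.restrict (Set.Ioo a b))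

/-- `f` is locally absolutely continuous with derivative `f'`. -/
def IsLocAC {E : Type*} [NormedAddCommGroup E] [NormedSpace ℝ E] (f f' : ℝ → E) : Prop :=
  LocallyIntegrable f' volume ∧ ∀ a b : ℝ, a < b → f b - f a = ∫ t in a..b, f' t

/-- `f` is a strongly quasisymmetric homeomorphism of `ℝ` with derivative `f'`:
an increasing homeomorphism of `ℝ` onto itself, locally absolutely continuous,
whose derivative is an `A_∞`-weight. -/
def IsSQSWith (f f' : ℝ → ℝ) : Prop :=
  StrictMono f ∧ Function.Surjective f ∧ IsLocAC f f' ∧ IsAInftyWeight f'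

/-- `f` is a strongly quasisymmetric homeomorphism of `ℝ` onto itself. -/
def IsSQS (f : ℝ → ℝ) : Prop :=
  ∃ f', IsSQSWith f f'

/-- `γ_u(x) = ∫_0^x e^{u(t)} dt`. -/
noncomputable def gammaOf (u : ℝ → ℝ) (x : ℝ) : ℝ :=
  ∫ t in (0:ℝ)..x, Real.exp (u t)

end

theorem MeasureTheory.LocallyIntegrable.intervalIntegrable {f : ℝ → ℝ}
    (hf : LocallyIntegrable f volume) {a b : ℝ} : IntervalIntegrable f volume a b :=
  (hf.integrableOn_isCompact isCompact_uIcc).intervalIntegrable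

/-- The sum of `Φ` over the `2 ^ n` dyadic subintervals of generation `n` of `(a, b]`. -/
noncomputable def dyadicSum (Φ : ℝ → ℝ → ℝ) : ℕ → ℝ → ℝ → ℝ
  | 0, a, b => Φ a b
  | n + 1, a, b => dyadicSum Φ n a ((a + b) / 2) + dyadicSum Φ n ((a + b) / 2) b

/-- The endpoints of the dyadic subinterval of generation `n` of `(a, b]` containing `x`. -/
noncomputable def dyadicEndpoints : ℕ → ℝ → ℝ → ℝ → ℝ × ℝ
  | 0, a, b, _ => (a, b)
  | n + 1, a, b, x =>
    if x ≤ (a + b) / 2 then dyadicEndpoints n a ((a + b) / 2) x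
    else dyadicEndpoints n ((a + b) / 2) b x

/-- The average of `h` over the dyadic subinterval of generation `n` of `(a, b]` containing `x`. -/
noncomputable def dyadicAvg (h : ℝ → ℝ) (n : ℕ) (a b x : ℝ) : ℝ :=
  intervalAvg h (dyadicEndpoints n a b x).1 (dyadicEndpoints n a b x).2

theorem dyadicAvg_succ (h : ℝ → ℝ) (n : ℕ) (a b x : ℝ) :
    dyadicAvg h (n + 1) a b x =
      if x ≤ (a + b) / 2 then dyadicAvg h n a ((a + b) / 2) x
      else dyadicAvg h n ((a + b) / 2) b x := by
  unfold dyadicAvg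
  rw [dyadicEndpoints]
  split_ifs <;> rfl

theorem measurable_dyadicAvg (h : ℝ → ℝ) (n : ℕ) (a b : ℝ) :
    Measurable (dyadicAvg h n a b) := by
  induction n generalizing a b with
  | zero => exact measurable_const (a := intervalAvg h a b)
  | succ n ih =>
    have : dyadicAvg h (n + 1) a b = fun x =>
        if x ≤ (a + b) / 2 then dyadicAvg h n a ((a + b) / 2) x
        else dyadicAvg h n ((a + b) / 2) b x := funext fun x => dyadicAvg_succ h n a b x
    rw [this]
    exact Measurable.ite measurableSet_Iic (ih _ _) (ih _ _)

theorem dyadicEndpoints_spec (n : ℕ) {a b x : ℝ} (hx : x ∈ Ioc a b) :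
    x ∈ Ioc (dyadicEndpoints n a b x).1 (dyadicEndpoints n a b x).2 ∧
      (dyadicEndpoints n a b x).2 - (dyadicEndpoints n a b x).1 = (b - a) / 2 ^ n := by
  induction n generalizing a b with
  | zero => simpa [dyadicEndpoints] using hx
  | succ n ih =>
    rw [dyadicEndpoints]
    split_ifs with hm
    · obtain ⟨h1, h2⟩ := ih (a := a) (b := (a + b) / 2) ⟨hx.1, hm⟩
      refine ⟨h1, h2.trans ?_⟩
      rw [pow_succ]
      field_simp
      ring
    · obtain ⟨h1, h2⟩ := ih (a := (a + b) / 2) (b := b) ⟨not_le.1 hm, hx.2⟩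
      refine ⟨h1, h2.trans ?_⟩
      rw [pow_succ]
      field_simp
      ring

/-- Dyadic averages converge almost everywhere (Lebesgue differentiation). -/
theorem ae_tendsto_dyadicAvg {h : ℝ → ℝ} (hh : LocallyIntegrable h volume) {a b : ℝ}
    (hab : a < b) :
    ∀ᵐ x ∂(volume.restrict (Ioc a b)),
      Tendsto (fun n => dyadicAvg h n a b x) atTop (𝓝 (h x)) := by
  have key := IsUnifLocDoublingMeasure.ae_tendsto_average (μ := volume) hh 1
  filter_upwards [ae_restrict_of_ae key, ae_restrict_mem measurableSet_Ioc] with x hx hxI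
  set l : ℕ → ℝ := fun n => (dyadicEndpoints n a b x).1 with hl
  set r : ℕ → ℝ := fun n => (dyadicEndpoints n a b x).2 with hr
  have hlr : ∀ n, r n - l n = (b - a) / 2 ^ n := fun n => (dyadicEndpoints_spec n hxI).2
  have hmem : ∀ n, x ∈ Ioc (l n) (r n) := fun n => (dyadicEndpoints_spec n hxI).1
  have hlim : Tendsto (fun n => (r n - l n) / 2) atTop (𝓝[>] 0) := by
    refine tendsto_nhdsWithin_iff.2 ⟨?_, Eventually.of_forall fun n => ?_⟩
    · have h2 : Tendsto (fun n : ℕ => (b - a) / 2 * (1 / 2 : ℝ) ^ n) atTop (𝓝 ((b - a) / 2 * 0)) :=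
        (tendsto_pow_atTop_nhds_zero_of_lt_one (by norm_num) (by norm_num)).const_mul _
      rw [mul_zero] at h2
      refine h2.congr fun n => ?_
      rw [hlr, one_div, inv_pow]
      field_simp
    · rw [mem_Ioi, hlr]
      have := sub_pos.2 hab
      positivity
  have := hx (fun n => (l n + r n) / 2) (fun n => (r n - l n) / 2) hlim
    (Eventually.of_forall fun n => by
      rw [Real.closedBall_eq_Icc]
      constructor <;> linarith [(hmem n).1, (hmem n).2])
  refine this.congr fun n => ?_
  have hlt : l n < r n := (hmem n).1.trans_le (hmem n).2
  have e1 : (l n + r n) / 2 - (r n - l n) / 2 = l n := by ring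
  have e2 : (l n + r n) / 2 + (r n - l n) / 2 = r n := by ring
  rw [Real.closedBall_eq_Icc, e1, e2, setAverage_eq, integral_Icc_eq_integral_Ioc,
    ← intervalIntegral.integral_of_le hlt.le, measureReal_def, Real.volume_Icc,
    ENNReal.toReal_ofReal (sub_pos.2 hlt).le]
  rfl

/-- A stopping-time argument: a superadditive majorant of `Φ` on the intervals satisfying `S`, which
also controls the dyadic sums on the halves leaving `S`, majorizes the dyadic sums of `Φ`. -/
theorem dyadicSum_le_of_stopping {Φ X : ℝ → ℝ → ℝ} {S : ℝ → ℝ → Prop} (n : ℕ)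
    (hX : ∀ a b, a < b → X a ((a + b) / 2) + X ((a + b) / 2) b ≤ X a b)
    (h₀ : ∀ a b, a < b → S a b → Φ a b ≤ X a b)
    (hleave : ∀ a b c d, S a b → a ≤ c → c < d → d ≤ b → b - a = 2 * (d - c) → ¬ S c d →
      ∀ k < n, dyadicSum Φ k c d ≤ X c d) :
    ∀ k ≤ n, ∀ a b, a < b → S a b → dyadicSum Φ k a b ≤ X a b := by
  intro k
  induction k with
  | zero => exact fun _ a b hab hS => h₀ a b hab hS
  | succ k ih =>
    intro hk a b hab hS
    rw [dyadicSum]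
    refine le_trans (add_le_add ?_ ?_) (hX a b hab)
    · by_cases h : S a ((a + b) / 2)
      · exact ih (by omega) _ _ (by linarith) h
      · exact hleave a b _ _ hS le_rfl (by linarith) (by linarith) (by ring) h k (by omega)
    · by_cases h : S ((a + b) / 2) b
      · exact ih (by omega) _ _ (by linarith) h
      · exact hleave a b _ _ hS (by linarith) (by linarith) le_rfl (by ring) h k (by omega)

theorem lintegral_mul_exp_dyadicAvg {w h : ℝ → ℝ} (hw₀ : ∀ x, 0 ≤ w x)
    (hw : LocallyIntegrable w volume) (n : ℕ) {a b : ℝ} (hab : a ≤ b) :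
    ∫⁻ x in Ioc a b, ENNReal.ofReal (w x * Real.exp (dyadicAvg h n a b x)) =
      ENNReal.ofReal
        (dyadicSum (fun c d => (∫ x in c..d, w x) * Real.exp (intervalAvg h c d)) n a b) := by
  have hΦ : ∀ n : ℕ, ∀ c d : ℝ, c ≤ d → 0 ≤
      dyadicSum (fun c d => (∫ x in c..d, w x) * Real.exp (intervalAvg h c d)) n c d := by
    intro n
    induction n with
    | zero =>
      exact fun c d hcd => mul_nonneg
        (intervalIntegral.integral_nonneg hcd fun x _ => hw₀ x) (Real.exp_pos _).le
    | succ n ih =>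
      exact fun c d hcd => add_nonneg (ih _ _ (by linarith)) (ih _ _ (by linarith))
  induction n generalizing a b with
  | zero =>
    have hi : IntegrableOn (fun x => w x * Real.exp (intervalAvg h a b)) (Ioc a b) :=
      ((hw.integrableOn_isCompact isCompact_Icc).mono_set Ioc_subset_Icc_self).mul_const _
    simp only [dyadicAvg, dyadicEndpoints, dyadicSum]
    rw [← ofReal_integral_eq_lintegral_ofReal hi
      (Eventually.of_forall fun x => mul_nonneg (hw₀ x) (Real.exp_pos _).le),
      ← intervalIntegral.integral_of_le hab, intervalIntegral.integral_mul_const]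
  | succ n ih =>
    have h1 : a ≤ (a + b) / 2 := by linarith
    have h2 : (a + b) / 2 ≤ b := by linarith
    rw [dyadicSum, ENNReal.ofReal_add (hΦ _ _ _ h1) (hΦ _ _ _ h2), ← ih h1, ← ih h2,
      ← Ioc_union_Ioc_eq_Ioc h1 h2,
      lintegral_union measurableSet_Ioc (Ioc_disjoint_Ioc_of_le le_rfl)]
    congr 1
    · refine setLIntegral_congr_fun measurableSet_Ioc fun x hx => ?_
      simp only [dyadicAvg_succ, if_pos hx.2]
    · refine setLIntegral_congr_fun measurableSet_Ioc fun x hx => ?_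
      simp only [dyadicAvg_succ, if_neg (not_le.2 hx.1)]

/-- Fatou's lemma turns bounds on dyadic sums into exponential integrability. -/
theorem integral_mul_exp_le_of_dyadicSum_le {w h : ℝ → ℝ} (hw₀ : ∀ x, 0 ≤ w x)
    (hw : LocallyIntegrable w volume) (hh : LocallyIntegrable h volume) {a b M : ℝ} (hab : a < b)
    (hM : ∀ n, dyadicSum (fun c d => (∫ x in c..d, w x) * Real.exp (intervalAvg h c d)) n a b ≤ M) :
    IntegrableOn (fun x => w x * Real.exp (h x)) (Ioc a b) ∧
      ∫ x in a..b, w x * Real.exp (h x) ≤ M := by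
  have hwm : AEMeasurable w (volume.restrict (Ioc a b)) :=
    hw.aestronglyMeasurable.aemeasurable.restrict
  have hhm : AEMeasurable h (volume.restrict (Ioc a b)) :=
    hh.aestronglyMeasurable.aemeasurable.restrict
  have hm : AEMeasurable (fun x => w x * Real.exp (h x)) (volume.restrict (Ioc a b)) :=
    hwm.mul hhm.exp
  have h0 : ∀ x, 0 ≤ w x * Real.exp (h x) := fun x => mul_nonneg (hw₀ x) (Real.exp_pos _).le
  have hM0 : 0 ≤ M := (mul_nonneg (intervalIntegral.integral_nonneg hab.le fun x _ => hw₀ x)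
    (Real.exp_pos _).le).trans (hM 0)
  have hle : ∫⁻ x in Ioc a b, ENNReal.ofReal (w x * Real.exp (h x)) ≤ ENNReal.ofReal M := by
    calc ∫⁻ x in Ioc a b, ENNReal.ofReal (w x * Real.exp (h x))
        = ∫⁻ x in Ioc a b, liminf
            (fun n => ENNReal.ofReal (w x * Real.exp (dyadicAvg h n a b x))) atTop := by
          refine lintegral_congr_ae ?_
          filter_upwards [ae_tendsto_dyadicAvg hh hab] with x hx
          exact (Tendsto.liminf_eq (ENNReal.tendsto_ofReal
            (((Real.continuous_exp.tendsto _).comp hx).const_mul _))).symm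
      _ ≤ liminf (fun n => ∫⁻ x in Ioc a b,
            ENNReal.ofReal (w x * Real.exp (dyadicAvg h n a b x))) atTop :=
          lintegral_liminf_le' fun n =>
            (hwm.mul (measurable_dyadicAvg h n a b).exp.aemeasurable).ennreal_ofReal
      _ ≤ ENNReal.ofReal M := by
          refine liminf_le_of_le (by isBoundedDefault) fun c hc => ?_
          obtain ⟨n, hn⟩ := hc.exists
          rw [lintegral_mul_exp_dyadicAvg hw₀ hw n hab.le] at hn
          exact hn.trans (ENNReal.ofReal_le_ofReal (hM n))
  have hi : IntegrableOn (fun x => w x * Real.exp (h x)) (Ioc a b) :=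
    ⟨hm.aestronglyMeasurable, (hasFiniteIntegral_iff_ofReal (Eventually.of_forall h0)).2
      (hle.trans_lt ENNReal.ofReal_lt_top)⟩
  refine ⟨hi, ?_⟩
  rw [intervalIntegral.integral_of_le hab.le,
    integral_eq_lintegral_of_nonneg_ae (Eventually.of_forall h0) hm.aestronglyMeasurable]
  exact ENNReal.toReal_le_of_le_ofReal hM0 hle

theorem abs_intervalAvg_sub_le {h : ℝ → ℝ} (hh : LocallyIntegrable h volume) (c : ℝ) {a b : ℝ}
    (hab : a < b) :
    |intervalAvg h a b - c| ≤ (b - a)⁻¹ * ∫ x in a..b, |h x - c| := by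
  have hpos := sub_pos.2 hab
  have hi := hh.intervalIntegrable (a := a) (b := b)
  have e : intervalAvg h a b - c = (b - a)⁻¹ * ∫ x in a..b, (h x - c) := by
    rw [intervalIntegral.integral_sub hi intervalIntegrable_const, intervalIntegral.integral_const,
      intervalAvg, smul_eq_mul, smul_eq_mul]
    field_simp
  rw [e, abs_mul, abs_of_pos (inv_pos.2 hpos)]
  exact mul_le_mul_of_nonneg_left (intervalIntegral.abs_integral_le_integral_abs hab.le)
    (inv_pos.2 hpos).le

/-- If `w` is rarely much smaller than its average, uniformly over all intervals, then the
exponential of a function of small mean oscillation is integrable against `w`. -/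
theorem exists_integral_mul_exp_le {w : ℝ → ℝ} (hw₀ : ∀ x, 0 ≤ w x)
    (hw : LocallyIntegrable w volume) {c : ℝ} (hc₀ : 0 < c) (hc₁ : c ≤ 1)
    (hc : ∀ a b : ℝ, a < b →
      ∫ x in a..b, max (c * intervalAvg w a b - w x) 0 ≤ c * intervalAvg w a b * (b - a) / 4) :
    ∃ ε > (0 : ℝ), ∃ B > (0 : ℝ), ∀ h : ℝ → ℝ, LocallyIntegrable h volume →
      (∀ a b : ℝ, a < b → ∫ x in a..b, |h x - intervalAvg h a b| ≤ ε * (b - a)) →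
      ∀ a b : ℝ, a < b → IntegrableOn (fun x => w x * Real.exp (h x)) (Ioc a b) ∧
        ∫ x in a..b, w x * Real.exp (h x) ≤ B * Real.exp (intervalAvg h a b) * ∫ x in a..b, w x := by
  obtain ⟨l, hl, hβ⟩ : ∃ l > (0 : ℝ), Real.exp (2 * l) * (1 - c / 2) < 1 := by
    have : Tendsto (fun l : ℝ => Real.exp (2 * l) * (1 - c / 2)) (𝓝[>] 0) (𝓝 (1 - c / 2)) := by
      have : Continuous fun l : ℝ => Real.exp (2 * l) * (1 - c / 2) := by fun_prop
      simpa using (this.tendsto 0).mono_left nhdsWithin_le_nhds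
    obtain ⟨l, h1, h2⟩ :=
      ((this.eventually_lt_const (by linarith : 1 - c / 2 < 1)).and self_mem_nhdsWithin).exists
    exact ⟨l, h2, h1⟩
  set β := 1 - c / 2 with hβdef
  have hβ0 : 0 ≤ β := by rw [hβdef]; linarith
  set B := Real.exp l / (1 - Real.exp (2 * l) * β) with hB
  have hden : 0 < 1 - Real.exp (2 * l) * β := by linarith
  have hBpos : 0 < B := div_pos (Real.exp_pos _) hden
  have hBeq : Real.exp l + B * Real.exp (2 * l) * β = B := by
    have : B * (1 - Real.exp (2 * l) * β) = Real.exp l := div_mul_cancel₀ _ hden.ne'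
    linarith
  refine ⟨l / 4, by positivity, B, hBpos, fun h hh hosc => ?_⟩
  set Φ : ℝ → ℝ → ℝ := fun c d => (∫ x in c..d, w x) * Real.exp (intervalAvg h c d) with hΦ
  have key : ∀ n, ∀ a b : ℝ, a < b →
      dyadicSum Φ n a b ≤ B * Real.exp (intervalAvg h a b) * ∫ x in a..b, w x := by
    intro n
    induction n using Nat.strong_induction_on with
    | _ n ih =>
    intro a b hab
    set m := intervalAvg h a b with hm
    set s := c * intervalAvg w a b with hs
    set g : ℝ → ℝ := fun x => max (s - w x) 0 with hg
    set f : ℝ → ℝ := fun x => |h x - m| with hf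
    have hba := sub_pos.2 hab
    have iw : ∀ p q, IntervalIntegrable w volume p q := fun p q => hw.intervalIntegrable
    have ig : ∀ p q, IntervalIntegrable g volume p q := fun p q =>
      ⟨((intervalIntegrable_const.sub (iw p q)).1).pos_part,
        ((intervalIntegrable_const.sub (iw p q)).2).pos_part⟩
    have jf : ∀ p q, IntervalIntegrable f volume p q := fun p q =>
      (hh.intervalIntegrable.sub intervalIntegrable_const).abs
    have hwI : ∀ p q, p ≤ q → 0 ≤ ∫ x in p..q, w x := fun p q hpq =>
      intervalIntegral.integral_nonneg hpq fun x _ => hw₀ x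
    have hfI : ∀ p q, p ≤ q → 0 ≤ ∫ x in p..q, f x := fun p q hpq =>
      intervalIntegral.integral_nonneg hpq fun x _ => abs_nonneg _
    have hgI : ∀ p q, p ≤ q → 0 ≤ ∫ x in p..q, g x := fun p q hpq =>
      intervalIntegral.integral_nonneg hpq fun x _ => le_max_right _ _
    have hwavg : intervalAvg w a b * (b - a) = ∫ x in a..b, w x := by
      rw [intervalAvg, smul_eq_mul]; field_simp
    have hs0 : 0 ≤ s := by
      refine mul_nonneg hc₀.le ?_
      rw [intervalAvg, smul_eq_mul]
      exact mul_nonneg (inv_pos.2 hba).le (hwI _ _ hab.le)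
    have hsw : ∀ p q, p ≤ q → s * (q - p) ≤ (∫ x in p..q, w x) + ∫ x in p..q, g x := by
      intro p q hpq
      rw [← intervalIntegral.integral_add (iw p q) (ig p q)]
      have := intervalIntegral.integral_mono_on hpq
        (intervalIntegrable_const (c := s)) ((iw p q).add (ig p q)) fun x _ => by
          have := le_max_left (s - w x) 0
          simp only [hg]
          linarith
      rw [intervalIntegral.integral_const, smul_eq_mul] at this
      linarith [this]
    set Ψ : ℝ → ℝ → ℝ := fun p q =>
      (∫ x in p..q, w x) + (∫ x in p..q, g x) - s * (q - p) + s / l * ∫ x in p..q, f x with hΨ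
    have hΨ0 : ∀ p q, p ≤ q → 0 ≤ Ψ p q := fun p q hpq => by
      have h1 := hsw p q hpq
      have h2 := mul_nonneg (div_nonneg hs0 hl.le) (hfI p q hpq)
      simp only [hΨ]
      linarith
    have hfab : ∫ x in a..b, f x ≤ l / 4 * (b - a) := hosc a b hab
    have hΨI : Ψ a b ≤ β * ∫ x in a..b, w x := by
      have h1 : ∫ x in a..b, g x ≤ s * (b - a) / 4 := hc a b hab
      have h2 : s / l * ∫ x in a..b, f x ≤ s / l * (l / 4 * (b - a)) :=
        mul_le_mul_of_nonneg_left hfab (div_nonneg hs0 hl.le)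
      have h3 : s / l * (l / 4 * (b - a)) = s * (b - a) / 4 := by field_simp
      have h4 : s * (b - a) = c * ∫ x in a..b, w x := by rw [hs, mul_assoc, hwavg]
      simp only [hΨ, hβdef]
      linarith
    have main := dyadicSum_le_of_stopping (Φ := Φ)
      (X := fun p q => Real.exp m *
        (Real.exp l * (∫ x in p..q, w x) + B * Real.exp (2 * l) * Ψ p q))
      (S := fun p q => ∫ x in p..q, f x ≤ l * (q - p)) n ?_ ?_ ?_ n le_rfl a b hab
      (hfab.trans (by nlinarith))
    · refine main.trans ?_
      have h1 := mul_le_mul_of_nonneg_left hΨI (by positivity : 0 ≤ B * Real.exp (2 * l))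
      calc _ ≤ Real.exp m * (Real.exp l * (∫ x in a..b, w x) +
              B * Real.exp (2 * l) * (β * ∫ x in a..b, w x)) := by gcongr
        _ = (Real.exp l + B * Real.exp (2 * l) * β) * Real.exp m * ∫ x in a..b, w x := by ring
        _ = _ := by rw [hBeq]
    · intro p q _
      have e1 := intervalIntegral.integral_add_adjacent_intervals (iw p ((p + q) / 2))
        (iw ((p + q) / 2) q)
      have e2 := intervalIntegral.integral_add_adjacent_intervals (ig p ((p + q) / 2))
        (ig ((p + q) / 2) q)
      have e3 := intervalIntegral.integral_add_adjacent_intervals (jf p ((p + q) / 2))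
        (jf ((p + q) / 2) q)
      simp only [hΨ, ← e1, ← e2, ← e3]
      exact le_of_eq (by ring)
    · intro p q hpq hS
      have h1 := abs_intervalAvg_sub_le hh m hpq
      have h2 : intervalAvg h p q ≤ m + l := by
        have h3 : (q - p)⁻¹ * ∫ x in p..q, f x ≤ l := by
          rw [inv_mul_le_iff₀ (sub_pos.2 hpq)]; linarith
        linarith [le_abs_self (intervalAvg h p q - m)]
      have h4 : 0 ≤ B * Real.exp (2 * l) * Ψ p q := mul_nonneg (by positivity) (hΨ0 p q hpq.le)
      calc Φ p q ≤ (∫ x in p..q, w x) * Real.exp (m + l) :=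
            mul_le_mul_of_nonneg_left (Real.exp_le_exp.2 h2) (hwI p q hpq.le)
        _ = Real.exp m * (Real.exp l * (∫ x in p..q, w x) + 0) := by rw [Real.exp_add]; ring
        _ ≤ _ := by gcongr
    · intro p q p' q' hS hp hpq' hq hlen hS' k hk
      have h0 := ih k hk p' q' hpq'
      have hlt : p < q := by linarith
      have hpos := sub_pos.2 hpq'
      have h1 := abs_intervalAvg_sub_le hh m hpq'
      have hmono : ∫ x in p'..q', f x ≤ ∫ x in p..q, f x :=
        intervalIntegral.integral_mono_interval hp hpq'.le hq
          (Eventually.of_forall fun x => abs_nonneg _) (jf p q)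
      have h2 : intervalAvg h p' q' ≤ m + 2 * l := by
        have h3 : (q' - p')⁻¹ * ∫ x in p'..q', f x ≤ 2 * l := by
          rw [inv_mul_le_iff₀ hpos]
          have : l * (q - p) = (q' - p') * (2 * l) := by rw [hlen]; ring
          linarith
        linarith [le_abs_self (intervalAvg h p' q' - m)]
      have h3 : ∫ x in p'..q', w x ≤ Ψ p' q' := by
        have h4 : s / l * (l * (q' - p')) ≤ s / l * ∫ x in p'..q', f x :=
          mul_le_mul_of_nonneg_left (not_le.1 hS').le (div_nonneg hs0 hl.le)
        have h5 : s / l * (l * (q' - p')) = s * (q' - p') := by field_simp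
        have := hgI p' q' hpq'.le
        simp only [hΨ]
        linarith
      have h6 := hwI p' q' hpq'.le
      calc _ ≤ B * Real.exp (intervalAvg h p' q') * ∫ x in p'..q', w x := h0
        _ ≤ B * Real.exp (m + 2 * l) * Ψ p' q' := by gcongr
        _ = Real.exp m * (0 + B * Real.exp (2 * l) * Ψ p' q') := by rw [Real.exp_add]; ring
        _ ≤ _ := by
          gcongr
          positivity
  exact fun a b hab => integral_mul_exp_le_of_dyadicSum_le hw₀ hw hh hab fun n => key n a b hab

/-- A Muckenhoupt condition for `exp g` implies that `exp g` is rarely much smaller than its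
average. -/
theorem exists_integral_max_le {g : ℝ → ℝ} {r D : ℝ} (hr : 0 < r) (hD : 0 < D)
    (h₁ : LocallyIntegrable (fun x => Real.exp (g x)) volume)
    (h₂ : LocallyIntegrable (fun x => Real.exp (-(r * g x))) volume)
    (hA : ∀ a b : ℝ, a < b → intervalAvg (fun x => Real.exp (g x)) a b ^ r *
      intervalAvg (fun x => Real.exp (-(r * g x))) a b ≤ D) :
    ∃ c > (0 : ℝ), c ≤ 1 ∧ ∀ a b : ℝ, a < b →
      ∫ x in a..b, max (c * intervalAvg (fun x => Real.exp (g x)) a b - Real.exp (g x)) 0 ≤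
        c * intervalAvg (fun x => Real.exp (g x)) a b * (b - a) / 4 := by
  refine ⟨min 1 ((1 / (4 * D)) ^ r⁻¹), by positivity, min_le_left _ _, fun a b hab => ?_⟩
  set c := min 1 ((1 / (4 * D)) ^ r⁻¹)
  have hc0 : 0 < c := by positivity
  have hcr : c ^ r ≤ 1 / (4 * D) := by
    calc c ^ r ≤ ((1 / (4 * D)) ^ r⁻¹) ^ r :=
          Real.rpow_le_rpow hc0.le (min_le_right _ _) hr.le
      _ = 1 / (4 * D) := Real.rpow_inv_rpow (by positivity) hr.ne'
  have hba := sub_pos.2 hab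
  set W := intervalAvg (fun x => Real.exp (g x)) a b with hW
  set Z := intervalAvg (fun x => Real.exp (-(r * g x))) a b with hZ
  have hW0 : 0 ≤ W := by
    rw [hW, intervalAvg, smul_eq_mul]
    exact mul_nonneg (inv_pos.2 hba).le
      (intervalIntegral.integral_nonneg hab.le fun x _ => (Real.exp_pos _).le)
  have hZ0 : 0 ≤ Z := by
    rw [hZ, intervalAvg, smul_eq_mul]
    exact mul_nonneg (inv_pos.2 hba).le
      (intervalIntegral.integral_nonneg hab.le fun x _ => (Real.exp_pos _).le)
  have hs0 : 0 ≤ c * W := mul_nonneg hc0.le hW0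
  have hpt : ∀ x, max (c * W - Real.exp (g x)) 0 ≤
      c * W * (c * W) ^ r * Real.exp (-(r * g x)) := by
    intro x
    refine max_le ?_ (by positivity)
    rcases le_or_gt (c * W) (Real.exp (g x)) with hx | hx
    · exact (sub_nonpos.2 hx).trans (by positivity)
    · have h3 : 1 ≤ (c * W) ^ r * Real.exp (-(r * g x)) := by
        have : Real.exp (r * g x) ≤ (c * W) ^ r := by
          have := Real.rpow_le_rpow (Real.exp_pos _).le hx.le hr.le
          rwa [← Real.exp_mul, mul_comm] at this
        rw [Real.exp_neg, ← div_eq_mul_inv, one_le_div (Real.exp_pos _)]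
        exact this
      have := mul_le_mul_of_nonneg_left h3 hs0
      linarith [Real.exp_pos (g x)]
  have hZeq : ∫ x in a..b, Real.exp (-(r * g x)) = Z * (b - a) := by
    rw [hZ, intervalAvg, smul_eq_mul]; field_simp
  have hle : (c * W) ^ r * Z ≤ 1 / 4 := by
    rw [Real.mul_rpow hc0.le hW0, mul_assoc]
    calc c ^ r * (W ^ r * Z) ≤ 1 / (4 * D) * D := by
          exact mul_le_mul hcr (hA a b hab) (mul_nonneg (by positivity) hZ0) (by positivity)
      _ = 1 / 4 := by field_simp
  have i₁ : IntervalIntegrable (fun x => c * W - Real.exp (g x)) volume a b :=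
    intervalIntegrable_const.sub h₁.intervalIntegrable
  calc ∫ x in a..b, max (c * W - Real.exp (g x)) 0
      ≤ ∫ x in a..b, c * W * (c * W) ^ r * Real.exp (-(r * g x)) :=
        intervalIntegral.integral_mono_on hab.le ⟨i₁.1.pos_part, i₁.2.pos_part⟩
          (h₂.intervalIntegrable.const_mul _) fun x _ => hpt x
    _ = c * W * (b - a) * ((c * W) ^ r * Z) := by
        rw [intervalIntegral.integral_const_mul, hZeq]; ring
    _ ≤ c * W * (b - a) * (1 / 4) := by gcongr
    _ = c * W * (b - a) / 4 := by ring

theorem locallyIntegrable_of_integrableOn_Ioc {f : ℝ → ℝ}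
    (hf : ∀ a b : ℝ, a < b → IntegrableOn f (Ioc a b)) : LocallyIntegrable f volume := fun x =>
  ⟨Ioc (x - 1) (x + 1), Ioc_mem_nhds (by linarith) (by linarith), hf _ _ (by linarith)⟩

theorem integral_abs_sub_intervalAvg_le {h : ℝ → ℝ} {ε : ℝ} (hε : 0 < ε)
    (hh : bmoSeminorm h < ENNReal.ofReal ε) {a b : ℝ} (hab : a < b) :
    ∫ x in a..b, |h x - intervalAvg h a b| ≤ ε * (b - a) := by
  have h1 : ENNReal.ofReal ((b - a)⁻¹ * ∫ x in a..b, ‖h x - intervalAvg h a b‖) ≤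
      bmoSeminorm h :=
    le_iSup_of_le a (le_iSup_of_le b (le_iSup_of_le hab le_rfl))
  have h2 := ((ENNReal.ofReal_lt_ofReal_iff hε).1 (h1.trans_lt hh)).le
  rw [inv_mul_le_iff₀ (sub_pos.2 hab)] at h2
  simpa only [Real.norm_eq_abs, mul_comm] using h2

theorem intervalAvg_const_mul (k : ℝ) (h : ℝ → ℝ) (a b : ℝ) :
    intervalAvg (fun x => k * h x) a b = k * intervalAvg h a b := by
  simp only [intervalAvg, smul_eq_mul, intervalIntegral.integral_const_mul]
  ring

theorem one_div_exp_rpow (x r : ℝ) : (1 / Real.exp x) ^ r = Real.exp (-(r * x)) := by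
  rw [one_div, ← Real.exp_neg, ← Real.exp_mul]
  ring_nf

theorem intervalAvg_exp_pos {g : ℝ → ℝ} (hg : LocallyIntegrable (fun x => Real.exp (g x)) volume)
    {a b : ℝ} (hab : a < b) : 0 < intervalAvg (fun x => Real.exp (g x)) a b := by
  rw [intervalAvg, smul_eq_mul]
  exact mul_pos (inv_pos.2 (sub_pos.2 hab)) (intervalIntegral.intervalIntegral_pos_of_pos
    hg.intervalIntegrable (fun x => Real.exp_pos _) hab)

/-- `BMO_ℝ^*(ℝ)` is open in the BMO seminorm. -/
theorem statement3 (u : ℝ → ℝ) (hu : IsBMO u)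
    (hA : IsAInftyWeight fun x => Real.exp (u x)) :
    ∃ ε > (0:ℝ), ∀ v : ℝ → ℝ, IsBMO v →
      bmoSeminorm (fun x => v x - u x) < ENNReal.ofReal ε →
      IsAInftyWeight fun x => Real.exp (v x) := by
  obtain ⟨p, hp, -, hω, hσ, C, hC1, hC⟩ := hA
  simp only [one_div_exp_rpow] at hσ hC
  set r := 1 / (p - 1) with hr
  have hp1 : 0 < p - 1 := sub_pos.2 hp
  have hr0 : 0 < r := one_div_pos.2 hp1
  have hpr : p - 1 = r⁻¹ := by rw [hr, one_div, inv_inv]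
  rw [hpr] at hC
  have hC0 : 0 < C := by linarith
  have hC' : ∀ a b : ℝ, a < b → intervalAvg (fun x => Real.exp (u x)) a b *
      intervalAvg (fun x => Real.exp (-(r * u x))) a b ^ r⁻¹ ≤ C := hC
  have hCr : ∀ a b : ℝ, a < b → intervalAvg (fun x => Real.exp (u x)) a b ^ r *
      intervalAvg (fun x => Real.exp (-(r * u x))) a b ≤ C ^ r := by
    intro a b hab
    have h1 := (intervalAvg_exp_pos hω hab).le
    have h2 := (intervalAvg_exp_pos hσ hab).le
    have h3 := Real.rpow_le_rpow (by positivity) (hC' a b hab) hr0.le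
    rwa [Real.mul_rpow h1 (by positivity), Real.rpow_inv_rpow h2 hr0.ne'] at h3
  have hback : (fun x => Real.exp (-(r⁻¹ * -(r * u x)))) = fun x => Real.exp (u x) := by
    funext x
    congr 1
    field_simp
  obtain ⟨c₁, hc₁, hc₁', hm₁⟩ := exists_integral_max_le hr0 (by positivity) hω hσ hCr
  obtain ⟨c₂, hc₂, hc₂', hm₂⟩ := exists_integral_max_le (g := fun x => -(r * u x))
    (inv_pos.2 hr0) hC0 hσ (by rwa [hback]) (fun a b hab => by
      rw [hback, mul_comm]
      exact hC' a b hab)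
  obtain ⟨ε₁, hε₁, B₁, hB₁, H₁⟩ :=
    exists_integral_mul_exp_le (fun x => (Real.exp_pos _).le) hω hc₁ hc₁' hm₁
  obtain ⟨ε₂, hε₂, B₂, hB₂, H₂⟩ :=
    exists_integral_mul_exp_le (fun x => (Real.exp_pos _).le) hσ hc₂ hc₂' hm₂
  refine ⟨min ε₁ (ε₂ / r), by positivity, fun v hv hvu => ?_⟩
  set h : ℝ → ℝ := fun x => v x - u x with hh
  have hhi : LocallyIntegrable h volume := hv.1.sub hu.1
  have hosc : ∀ a b : ℝ, a < b →
      ∫ x in a..b, |h x - intervalAvg h a b| ≤ min ε₁ (ε₂ / r) * (b - a) :=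
    fun a b hab => integral_abs_sub_intervalAvg_le (by positivity) hvu hab
  have K₁ := H₁ h hhi fun a b hab => (hosc a b hab).trans
    (mul_le_mul_of_nonneg_right (min_le_left _ _) (sub_pos.2 hab).le)
  have K₂ := H₂ (fun x => -r * h x) (hhi.smul (-r)) fun a b hab => by
    simp only [intervalAvg_const_mul, ← mul_sub, abs_mul, abs_neg, abs_of_pos hr0,
      intervalIntegral.integral_const_mul]
    calc r * ∫ x in a..b, |h x - intervalAvg h a b|
        ≤ r * (ε₂ / r * (b - a)) := by
          refine mul_le_mul_of_nonneg_left ((hosc a b hab).trans ?_) hr0.le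
          exact mul_le_mul_of_nonneg_right (min_le_right _ _) (sub_pos.2 hab).le
      _ = ε₂ * (b - a) := by field_simp
  have e₁ : (fun x => Real.exp (u x) * Real.exp (h x)) = fun x => Real.exp (v x) := by
    funext x
    rw [← Real.exp_add, hh]
    ring_nf
  have e₂ : (fun x => Real.exp (-(r * u x)) * Real.exp (-r * h x)) =
      fun x => Real.exp (-(r * v x)) := by
    funext x
    rw [← Real.exp_add, hh]
    ring_nf
  simp only [intervalAvg_const_mul, congrFun e₁, congrFun e₂] at K₁ K₂
  have hv₁ : LocallyIntegrable (fun x => Real.exp (v x)) volume :=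
    locallyIntegrable_of_integrableOn_Ioc fun a b hab => (K₁ a b hab).1
  have hv₂ : LocallyIntegrable (fun x => Real.exp (-(r * v x))) volume :=
    locallyIntegrable_of_integrableOn_Ioc fun a b hab => (K₂ a b hab).1
  refine ⟨p, hp, fun x => (Real.exp_pos _).le, hv₁, ?_, max 1 (B₁ * B₂ ^ r⁻¹ * C),
    le_max_left _ _, fun a b hab => ?_⟩
  · simpa only [one_div_exp_rpow] using hv₂
  simp only [one_div_exp_rpow, ← hr]
  rw [hpr]
  refine le_trans ?_ (le_max_right _ _)
  set m := intervalAvg h a b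
  set W := intervalAvg (fun x => Real.exp (u x)) a b with hW
  set Z := intervalAvg (fun x => Real.exp (-(r * u x))) a b with hZ
  have hW0 : 0 < W := intervalAvg_exp_pos hω hab
  have hZ0 : 0 < Z := intervalAvg_exp_pos hσ hab
  have hba := inv_pos.2 (sub_pos.2 hab)
  have L₁ : (b - a)⁻¹ * ∫ x in a..b, Real.exp (v x) ≤ B₁ * Real.exp m * W := by
    refine (mul_le_mul_of_nonneg_left (K₁ a b hab).2 hba.le).trans (le_of_eq ?_)
    have e : W = (b - a)⁻¹ * ∫ x in a..b, Real.exp (u x) := rfl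
    rw [e]
    ring
  have L₂ : (b - a)⁻¹ * ∫ x in a..b, Real.exp (-(r * v x)) ≤ B₂ * Real.exp (-r * m) * Z := by
    refine (mul_le_mul_of_nonneg_left (K₂ a b hab).2 hba.le).trans (le_of_eq ?_)
    have e : Z = (b - a)⁻¹ * ∫ x in a..b, Real.exp (-(r * u x)) := rfl
    rw [e]
    ring
  have hZv : 0 < (b - a)⁻¹ * ∫ x in a..b, Real.exp (-(r * v x)) := intervalAvg_exp_pos hv₂ hab
  have hexp : Real.exp m * Real.exp (-r * m) ^ r⁻¹ = 1 := by
    rw [← Real.exp_mul, ← Real.exp_add, Real.exp_eq_one_iff]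
    field_simp
    ring
  calc _ ≤ (B₁ * Real.exp m * W) * (B₂ * Real.exp (-r * m) * Z) ^ r⁻¹ :=
        mul_le_mul L₁ (Real.rpow_le_rpow hZv.le L₂ (inv_pos.2 hr0).le) (by positivity)
          (by positivity)
    _ = B₁ * B₂ ^ r⁻¹ * (Real.exp m * Real.exp (-r * m) ^ r⁻¹) * (W * Z ^ r⁻¹) := by
        rw [Real.mul_rpow (by positivity) hZ0.le, Real.mul_rpow hB₂.le (Real.exp_pos _).le]
        ring
    _ ≤ B₁ * B₂ ^ r⁻¹ * C := by
        rw [hexp, mul_one]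
        exact mul_le_mul_of_nonneg_left (hC' a b hab) (by positivity)
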